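/- In the polynomial ring over C with variables x_0,...,x_7, the ideal I generated by x_0x_7, x_0x_4, x_0x_5, x_0x_6, x_1x_6, x_2x_5, x_3x_4, x_1x_7 - x_4x_5, x_2x_7 - x_4x_6, x_3x_7 - x_5x_6, x_1x_2x_3 defines a projective scheme X ⊂ P^7 of dimension 2 and degree 12. -/

import Mathlib

open MvPolynomial

namespace DegreeTwelve

/-- Index sets of the coordinates spanning the linear hulls of the components of `X`: six planes
and three quadrics `x₁x₇ = x₄x₅`, `x₂x₇ = x₄x₆`, `x₃x₇ = x₅x₆`, each in a `ℙ³`. -/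
def cells : Finset (Finset (Fin 8)) :=
  {{0, 1, 2}, {0, 1, 3}, {0, 2, 3}, {1, 2, 4}, {1, 3, 5}, {2, 3, 6},
    {1, 4, 5, 7}, {2, 4, 6, 7}, {3, 5, 6, 7}}

/-- Facets of the triangulated 2-sphere obtained by cutting each quadrilateral of `cells` along
the diagonal through `7`; it is the Stanley-Reisner complex of an initial ideal of `I`. -/
def facets : Finset (Finset (Fin 8)) :=
  {{0, 1, 2}, {0, 1, 3}, {0, 2, 3}, {1, 2, 4}, {1, 3, 5}, {2, 3, 6},
    {1, 4, 7}, {1, 5, 7}, {2, 4, 7}, {2, 6, 7}, {3, 5, 7}, {3, 6, 7}}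

/-- A monomial is standard if its support is a face of the triangulated sphere. -/
def IsStandard (u : Fin 8 →₀ ℕ) : Prop := ∃ F ∈ facets, u.support ⊆ F

instance : DecidablePred IsStandard := fun u => by unfold IsStandard; infer_instance

lemma ringKrullDim_quotient_le_of_forall_isPrime {R : Type*} [CommRing R] {I : Ideal R}
    {n : WithBot ℕ∞} (h : ∀ P : Ideal R, P.IsPrime → I ≤ P → ringKrullDim (R ⧸ P) ≤ n) :
    ringKrullDim (R ⧸ I) ≤ n := by
  rw [ringKrullDim_quotient]
  refine iSup_le fun l => ?_
  refine le_trans ?_ (h l.head.1.asIdeal l.head.1.isPrime l.head.2)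
  rw [ringKrullDim_quotient]
  let l' : LTSeries (PrimeSpectrum.zeroLocus (l.head.1.asIdeal : Set R)) :=
    ⟨l.length, fun i => ⟨(l i).1, (show l.head.1 ≤ (l i).1 from l.head_le i)⟩, l.step⟩
  exact Order.LTSeries.length_le_krullDim l'

lemma aeval_mk_X_surjective {σ k : Type*} [Field k] {P : Ideal (MvPolynomial σ k)}
    {C : Finset σ} (h : ∀ i ∉ C, (X i : MvPolynomial σ k) ∈ P) :
    Function.Surjective (aeval (fun i : C => Ideal.Quotient.mkₐ k P (X i.1)) :
      MvPolynomial C k →ₐ[k] MvPolynomial σ k ⧸ P) := by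
  classical
  intro y
  obtain ⟨p, rfl⟩ := Ideal.Quotient.mk_surjective y
  induction p using MvPolynomial.induction_on with
  | C a => exact ⟨MvPolynomial.C a, by simp; rfl⟩
  | add p q hp hq =>
    obtain ⟨a, ha⟩ := hp
    obtain ⟨b, hb⟩ := hq
    exact ⟨a + b, by rw [map_add, ha, hb, map_add]⟩
  | mul_X p i hp =>
    obtain ⟨a, ha⟩ := hp
    by_cases hi : i ∈ C
    · exact ⟨a * X ⟨i, hi⟩, by rw [map_mul, ha, map_mul, aeval_X]; rfl⟩
    · exact ⟨0, by rw [map_mul, Ideal.Quotient.eq_zero_iff_mem.2 (h i hi), mul_zero, map_zero]⟩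

lemma ringKrullDim_le_card {σ k : Type*} [Field k] {P : Ideal (MvPolynomial σ k)}
    {C : Finset σ} (h : ∀ i ∉ C, (X i : MvPolynomial σ k) ∈ P) :
    ringKrullDim (MvPolynomial σ k ⧸ P) ≤ C.card := by
  have := ringKrullDim_le_of_surjective _ (aeval_mk_X_surjective h)
  simpa using this

lemma ringKrullDim_add_one_le_card {σ k : Type*} [Field k] {P : Ideal (MvPolynomial σ k)}
    {C : Finset σ} (h : ∀ i ∉ C, (X i : MvPolynomial σ k) ∈ P) {f : MvPolynomial C k}
    (hf : f ≠ 0) (hfP : rename Subtype.val f ∈ P) :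
    ringKrullDim (MvPolynomial σ k ⧸ P) + 1 ≤ C.card := by
  have := ringKrullDim_succ_le_of_surjective
    (aeval (fun i : C => Ideal.Quotient.mkₐ k P (X i.1)) :
      MvPolynomial C k →ₐ[k] MvPolynomial σ k ⧸ P).toRingHom (aeval_mk_X_surjective h)
    (mem_nonZeroDivisors_of_ne_zero hf) (by
      have h0 := Ideal.Quotient.eq_zero_iff_mem.2 hfP
      have hc : (aeval (fun i : C => Ideal.Quotient.mkₐ k P (X i.1)) :
          MvPolynomial C k →ₐ[k] MvPolynomial σ k ⧸ P)
          = (Ideal.Quotient.mkₐ k P).comp (rename Subtype.val) := by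
        ext i; simp
      exact (DFunLike.congr_fun hc f).trans h0)
  simpa using this

lemma X_mul_X_sub_ne_zero {σ k : Type*} [Field k] {a b c d : σ} (hca : c ≠ a) (hcb : c ≠ b) :
    (X a * X b - X c * X d : MvPolynomial σ k) ≠ 0 := by
  classical
  intro h
  have := congrArg (eval (fun i => if i = c then (0 : k) else 1)) h
  simp [hca.symm, hcb.symm] at this

/-- The ideal of the degree 12 surface. -/
noncomputable def surfaceIdeal : Ideal (MvPolynomial (Fin 8) ℂ) :=
  Ideal.span {X 0 * X 7, X 0 * X 4, X 0 * X 5, X 0 * X 6,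
      X 1 * X 6, X 2 * X 5, X 3 * X 4,
      X 1 * X 7 - X 4 * X 5, X 2 * X 7 - X 4 * X 6, X 3 * X 7 - X 5 * X 6,
      X 1 * X 2 * X 3}

/-- Index sets whose squarefree monomials lie in `surfaceIdeal`. -/
def vanishing : Finset (Finset (Fin 8)) :=
  {{0, 7}, {0, 4}, {0, 5}, {0, 6}, {1, 6}, {2, 5}, {3, 4}, {1, 2, 3},
    {1, 2, 7}, {1, 3, 7}, {2, 3, 7}, {4, 5, 6}}

lemma exists_vanishing_subset_or_subset_cell (s : Finset (Fin 8)) :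
    (∃ N ∈ vanishing, N ⊆ s) ∨ ∃ C ∈ cells, s ⊆ C := by
  simp only [vanishing, cells, Finset.exists_mem_insert, Finset.mem_singleton, exists_eq_left,
    Finset.subset_iff, Fin.forall_fin_succ]
  simp
  grind

lemma exists_vanishing_subset_or_subset_facet (s : Finset (Fin 8)) :
    (∃ N ∈ vanishing, N ⊆ s) ∨ {4, 5} ⊆ s ∨ {4, 6} ⊆ s ∨ {5, 6} ⊆ s ∨ ∃ F ∈ facets, s ⊆ F := by
  simp only [vanishing, facets, Finset.exists_mem_insert, Finset.mem_singleton, exists_eq_left,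
    Finset.subset_iff, Fin.forall_fin_succ]
  simp
  grind

lemma sub_mem_surfaceIdeal :
    (X 1 * X 7 - X 4 * X 5 : MvPolynomial (Fin 8) ℂ) ∈ surfaceIdeal ∧
    (X 2 * X 7 - X 4 * X 6 : MvPolynomial (Fin 8) ℂ) ∈ surfaceIdeal ∧
    (X 3 * X 7 - X 5 * X 6 : MvPolynomial (Fin 8) ℂ) ∈ surfaceIdeal := by
  refine ⟨?_, ?_, ?_⟩ <;> exact Ideal.subset_span (by simp)

lemma prod_X_mem_surfaceIdeal {N : Finset (Fin 8)} (hN : N ∈ vanishing) :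
    (∏ i ∈ N, X i : MvPolynomial (Fin 8) ℂ) ∈ surfaceIdeal := by
  have h16 : (X 1 * X 6 : MvPolynomial (Fin 8) ℂ) ∈ surfaceIdeal :=
    Ideal.subset_span (by simp)
  have h25 : (X 2 * X 5 : MvPolynomial (Fin 8) ℂ) ∈ surfaceIdeal :=
    Ideal.subset_span (by simp)
  have h34 : (X 3 * X 4 : MvPolynomial (Fin 8) ℂ) ∈ surfaceIdeal :=
    Ideal.subset_span (by simp)
  obtain ⟨h1, h2, h3⟩ := sub_mem_surfaceIdeal
  simp only [vanishing, Finset.mem_insert, Finset.mem_singleton] at hN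
  rcases hN with rfl | rfl | rfl | rfl | rfl | rfl | rfl | rfl | rfl | rfl | rfl | rfl
  iterate 7 exact Ideal.subset_span (by simp)
  · exact Ideal.subset_span (by simp [mul_assoc])
  · convert add_mem (Ideal.mul_mem_left _ (X 2) h1) (Ideal.mul_mem_left _ (X 4) h25) using 1
    simp; ring
  · convert add_mem (Ideal.mul_mem_left _ (X 3) h1) (Ideal.mul_mem_left _ (X 5) h34) using 1
    simp; ring
  · convert add_mem (Ideal.mul_mem_left _ (X 3) h2) (Ideal.mul_mem_left _ (X 6) h34) using 1
    simp; ring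
  · convert sub_mem (Ideal.mul_mem_left _ (X 7) h16) (Ideal.mul_mem_left _ (X 6) h1) using 1
    simp; ring

lemma exists_cell_of_isPrime {P : Ideal (MvPolynomial (Fin 8) ℂ)} (hP : P.IsPrime)
    (hI : surfaceIdeal ≤ P) :
    ∃ C ∈ cells, ∀ i ∉ C, (X i : MvPolynomial (Fin 8) ℂ) ∈ P := by
  classical
  rcases exists_vanishing_subset_or_subset_cell (Finset.univ.filter fun i => (X i : MvPolynomial (Fin 8) ℂ) ∉ P) with
    ⟨N, hN, hs⟩ | ⟨C, hC, hs⟩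
  · obtain ⟨i, hi, hiP⟩ := (Ideal.IsPrime.prod_mem_iff).1 (hI (prod_X_mem_surfaceIdeal hN))
    exact absurd hiP (Finset.mem_filter.1 (hs hi)).2
  · refine ⟨C, hC, fun i hi => ?_⟩
    by_contra h
    exact hi (hs (by simpa using h))

lemma ringKrullDim_quotient_surfaceIdeal_le :
    ringKrullDim (MvPolynomial (Fin 8) ℂ ⧸ surfaceIdeal) ≤ 3 := by
  refine ringKrullDim_quotient_le_of_forall_isPrime fun P hP hI => ?_
  have quadric {C : Finset (Fin 8)} {a b c d : Fin 8} (hC : C.card = 4)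
      (h : ∀ i ∉ C, (X i : MvPolynomial (Fin 8) ℂ) ∈ P)
      (ha : a ∈ C) (hb : b ∈ C) (hc : c ∈ C) (hd : d ∈ C) (hca : c ≠ a) (hcb : c ≠ b)
      (hf : (X a * X b - X c * X d : MvPolynomial (Fin 8) ℂ) ∈ surfaceIdeal) :
      ringKrullDim (MvPolynomial (Fin 8) ℂ ⧸ P) ≤ 3 := by
    have := ringKrullDim_add_one_le_card h
      (f := X ⟨a, ha⟩ * X ⟨b, hb⟩ - X ⟨c, hc⟩ * X ⟨d, hd⟩)
      (X_mul_X_sub_ne_zero (by simpa using hca) (by simpa using hcb)) (by simpa using hI hf)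
    rw [hC] at this
    exact ENat.WithBot.add_le_add_one_right_iff.1 (this.trans_eq (by norm_num))
  obtain ⟨h1, h2, h3⟩ := sub_mem_surfaceIdeal
  obtain ⟨C, hC, h⟩ := exists_cell_of_isPrime hP hI
  have card_or_eq : ∀ C ∈ cells, C.card = 3 ∨ C = {1, 4, 5, 7} ∨ C = {2, 4, 6, 7} ∨
      C = {3, 5, 6, 7} := by decide +kernel
  rcases card_or_eq C hC with h' | rfl | rfl | rfl
  · simpa [h'] using ringKrullDim_le_card h
  · exact quadric (by decide) h (by decide) (by decide) (by decide) (by decide) (by decide)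
      (by decide) h1
  · exact quadric (by decide) h (by decide) (by decide) (by decide) (by decide) (by decide)
      (by decide) h2
  · exact quadric (by decide) h (by decide) (by decide) (by decide) (by decide) (by decide)
      (by decide) h3

lemma le_ringKrullDim_quotient_surfaceIdeal :
    3 ≤ ringKrullDim (MvPolynomial (Fin 8) ℂ ⧸ surfaceIdeal) := by
  let f : MvPolynomial (Fin 8) ℂ →ₐ[ℂ] MvPolynomial (Fin 3) ℂ :=
    aeval ![X 0, X 1, X 2, 0, 0, 0, 0, 0]
  have hf : ∀ a ∈ surfaceIdeal, f a = 0 := by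
    intro a ha
    suffices surfaceIdeal ≤ RingHom.ker f from this ha
    rw [surfaceIdeal, Ideal.span_le]
    rintro x hx
    simp only [Set.mem_insert_iff, Set.mem_singleton_iff] at hx
    rcases hx with rfl | rfl | rfl | rfl | rfl | rfl | rfl | rfl | rfl | rfl | rfl <;>
      simp [f]
  have hs : Function.Surjective f := by
    intro p
    refine ⟨rename (Fin.castLE (by norm_num)) p, ?_⟩
    have : f.comp (rename (Fin.castLE (by norm_num : 3 ≤ 8))) = AlgHom.id ℂ _ := by
      ext i : 1
      fin_cases i <;> simp [f]
    exact DFunLike.congr_fun this p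
  have := ringKrullDim_le_of_surjective _
    (Ideal.Quotient.lift_surjective_of_surjective surfaceIdeal (f := f.toRingHom) hf hs)
  simpa using this

/-- The exponent of the squarefree monomial supported on `N`. -/
noncomputable def squarefreeExp (N : Finset (Fin 8)) : Fin 8 →₀ ℕ :=
  ∑ i ∈ N, Finsupp.single i 1

lemma squarefreeExp_apply (N : Finset (Fin 8)) (i : Fin 8) :
    squarefreeExp N i = if i ∈ N then 1 else 0 := by
  simp [squarefreeExp, Finsupp.finsetSum_apply, Finsupp.single_apply]

lemma support_add_squarefreeExp (w : Fin 8 →₀ ℕ) (N : Finset (Fin 8)) :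
    (w + squarefreeExp N).support = w.support ∪ N := by
  ext i
  simp [squarefreeExp_apply]
  tauto

lemma prod_X_eq_monomial (N : Finset (Fin 8)) :
    (∏ i ∈ N, X i : MvPolynomial (Fin 8) ℂ) = monomial (squarefreeExp N) 1 := by
  rw [squarefreeExp, monomial_sum_one]
  rfl

lemma exists_eq_add_squarefreeExp {u : Fin 8 →₀ ℕ} {N : Finset (Fin 8)} (h : N ⊆ u.support) :
    ∃ w, u = w + squarefreeExp N := by
  refine ⟨u - squarefreeExp N, (tsub_add_cancel_of_le fun i => ?_).symm⟩
  rw [squarefreeExp_apply]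
  split_ifs with hi
  · exact Nat.one_le_iff_ne_zero.2 (Finsupp.mem_support_iff.1 (h hi))
  · exact Nat.zero_le _

/-- Multidegree with respect to the torus acting on `X` (the last entry is the total degree). -/
def multidegree : (Fin 8 →₀ ℕ) →+ (Fin 5 → ℕ) where
  toFun u := ![u 0, u 1 + u 2 + u 4, u 1 + u 3 + u 5, u 2 + u 3 + u 6,
    u 0 + u 1 + u 2 + u 3 + u 4 + u 5 + u 6 + u 7]
  map_zero' := by ext i; fin_cases i <;> rfl
  map_add' u v := by
    ext i
    fin_cases i <;> simp <;> ring

/-- A monomial is supported on a cell. -/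
def OnCell (u : Fin 8 →₀ ℕ) : Prop := ∃ C ∈ cells, u.support ⊆ C

instance : DecidablePred OnCell := fun u => by unfold OnCell; infer_instance

/-- The projection of the polynomial ring to the toric face ring of the complex `cells`, as a
vector space with basis indexed by multidegrees. -/
noncomputable def toricProj : MvPolynomial (Fin 8) ℂ →ₗ[ℂ] ((Fin 5 → ℕ) →₀ ℂ) :=
  (basisMonomials (Fin 8) ℂ).constr ℂ fun u =>
    if OnCell u then Finsupp.single (multidegree u) 1 else 0

lemma toricProj_monomial (u : Fin 8 →₀ ℕ) (c : ℂ) :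
    toricProj (monomial u c) =
      c • if OnCell u then Finsupp.single (multidegree u) 1 else 0 := by
  have h : (monomial u c : MvPolynomial (Fin 8) ℂ) = c • basisMonomials (Fin 8) ℂ u := by
    simp [smul_monomial]
  rw [h, map_smul, toricProj, Module.Basis.constr_basis]

lemma toricProj_mul_eq_zero {g : MvPolynomial (Fin 8) ℂ}
    (h : ∀ w c, toricProj (monomial w c * g) = 0) (p : MvPolynomial (Fin 8) ℂ) :
    toricProj (p * g) = 0 := by
  induction p using MvPolynomial.induction_on' with
  | monomial u a => exact h u a
  | add p q hp hq => rw [add_mul, map_add, hp, hq, add_zero]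

lemma toricProj_mul_prod_eq_zero {N : Finset (Fin 8)} (hN : ∀ C ∈ cells, ¬ N ⊆ C)
    (p : MvPolynomial (Fin 8) ℂ) : toricProj (p * ∏ i ∈ N, X i) = 0 := by
  refine toricProj_mul_eq_zero (fun w c => ?_) p
  rw [prod_X_eq_monomial, monomial_mul, toricProj_monomial, if_neg, smul_zero]
  rintro ⟨C, hC, h⟩
  rw [support_add_squarefreeExp] at h
  exact hN C hC (Finset.union_subset_right h)

lemma toricProj_mul_sub_eq_zero {N M : Finset (Fin 8)}
    (h : ∀ C ∈ cells, N ⊆ C ↔ M ⊆ C)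
    (hd : multidegree (squarefreeExp N) = multidegree (squarefreeExp M))
    (p : MvPolynomial (Fin 8) ℂ) : toricProj (p * (∏ i ∈ N, X i - ∏ i ∈ M, X i)) = 0 := by
  refine toricProj_mul_eq_zero (fun w c => ?_) p
  have hiff : OnCell (w + squarefreeExp N) ↔ OnCell (w + squarefreeExp M) := by
    simp only [OnCell, support_add_squarefreeExp, Finset.union_subset_iff]
    exact exists_congr fun C => and_congr_right fun hC => and_congr_right fun _ => h C hC
  simp only [prod_X_eq_monomial, mul_sub, monomial_mul, map_sub, toricProj_monomial, hiff,
    map_add, hd, sub_self]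

lemma toricProj_eq_zero_of_mem {p : MvPolynomial (Fin 8) ℂ} (hp : p ∈ surfaceIdeal) :
    toricProj p = 0 := by
  have mono {i j : Fin 8} (hij : i ≠ j) (h : ∀ C ∈ cells, ¬ ({i, j} : Finset (Fin 8)) ⊆ C)
      (q : MvPolynomial (Fin 8) ℂ) : toricProj (q * (X i * X j)) = 0 := by
    simpa [Finset.prod_pair hij] using toricProj_mul_prod_eq_zero h q
  have bin {i j k l : Fin 8} (hij : i ≠ j) (hkl : k ≠ l)
      (h : ∀ C ∈ cells, ({i, j} : Finset (Fin 8)) ⊆ C ↔ ({k, l} : Finset (Fin 8)) ⊆ C)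
      (hd : multidegree (squarefreeExp {i, j}) = multidegree (squarefreeExp {k, l}))
      (q : MvPolynomial (Fin 8) ℂ) : toricProj (q * (X i * X j - X k * X l)) = 0 := by
    simpa [Finset.prod_pair hij, Finset.prod_pair hkl] using toricProj_mul_sub_eq_zero h hd q
  suffices ∀ q, toricProj (q * p) = 0 by simpa using this 1
  refine Submodule.span_induction (p := fun p _ => ∀ q, toricProj (q * p) = 0)
    ?_ (by simp) (fun x y _ _ hx hy q => by rw [mul_add, map_add, hx, hy, add_zero])
    (fun a x _ hx q => by rw [smul_eq_mul, ← mul_assoc, hx]) hp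
  intro x hx
  simp only [Set.mem_insert_iff, Set.mem_singleton_iff] at hx
  rcases hx with rfl | rfl | rfl | rfl | rfl | rfl | rfl | rfl | rfl | rfl | rfl
  iterate 7 exact mono (by decide) (by simp [cells, Finset.insert_subset_iff])
  iterate 3
    refine bin ?_ ?_ ?_ ?_
    · decide
    · decide
    · simp [cells, Finset.insert_subset_iff]
    · ext i; fin_cases i <;> simp [multidegree, squarefreeExp_apply]
  · intro q
    have := toricProj_mul_prod_eq_zero (N := {1, 2, 3})
      (by simp [cells, Finset.insert_subset_iff]) q
    simpa [mul_assoc] using this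

lemma IsStandard.zeros {u : Fin 8 →₀ ℕ} (hu : IsStandard u) :
    (u 3 = 0 ∧ u 4 = 0 ∧ u 5 = 0 ∧ u 6 = 0 ∧ u 7 = 0) ∨
    (u 2 = 0 ∧ u 4 = 0 ∧ u 5 = 0 ∧ u 6 = 0 ∧ u 7 = 0) ∨
    (u 1 = 0 ∧ u 4 = 0 ∧ u 5 = 0 ∧ u 6 = 0 ∧ u 7 = 0) ∨
    (u 0 = 0 ∧ u 3 = 0 ∧ u 5 = 0 ∧ u 6 = 0 ∧ u 7 = 0) ∨
    (u 0 = 0 ∧ u 2 = 0 ∧ u 4 = 0 ∧ u 6 = 0 ∧ u 7 = 0) ∨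
    (u 0 = 0 ∧ u 1 = 0 ∧ u 4 = 0 ∧ u 5 = 0 ∧ u 7 = 0) ∨
    (u 0 = 0 ∧ u 2 = 0 ∧ u 3 = 0 ∧ u 5 = 0 ∧ u 6 = 0) ∨
    (u 0 = 0 ∧ u 2 = 0 ∧ u 3 = 0 ∧ u 4 = 0 ∧ u 6 = 0) ∨
    (u 0 = 0 ∧ u 1 = 0 ∧ u 3 = 0 ∧ u 5 = 0 ∧ u 6 = 0) ∨
    (u 0 = 0 ∧ u 1 = 0 ∧ u 3 = 0 ∧ u 4 = 0 ∧ u 5 = 0) ∨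
    (u 0 = 0 ∧ u 1 = 0 ∧ u 2 = 0 ∧ u 4 = 0 ∧ u 6 = 0) ∨
    (u 0 = 0 ∧ u 1 = 0 ∧ u 2 = 0 ∧ u 4 = 0 ∧ u 5 = 0) := by
  obtain ⟨F, hF, h⟩ := hu
  have hz : ∀ i ∉ F, u i = 0 := fun i hi => Finsupp.notMem_support_iff.1 fun h' => hi (h h')
  simp only [facets, Finset.mem_insert, Finset.mem_singleton] at hF
  rcases hF with rfl | rfl | rfl | rfl | rfl | rfl | rfl | rfl | rfl | rfl | rfl | rfl <;>
  simp [hz]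

lemma multidegree_injOn_isStandard : Set.InjOn multidegree {u | IsStandard u} := by
  intro u hu v hv h
  have h0 := congrFun h 0
  have h1 := congrFun h 1
  have h2 := congrFun h 2
  have h3 := congrFun h 3
  have h4 := congrFun h 4
  simp [multidegree] at h0 h1 h2 h3 h4
  have hu := hu.zeros
  have hv := hv.zeros
  suffices u 0 = v 0 ∧ u 1 = v 1 ∧ u 2 = v 2 ∧ u 3 = v 3 ∧ u 4 = v 4 ∧ u 5 = v 5 ∧ u 6 = v 6 ∧
      u 7 = v 7 by
    ext i
    fin_cases i <;> simp [this]
  clear h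
  generalize u 0 = u0, u 1 = u1, u 2 = u2, u 3 = u3, u 4 = u4, u 5 = u5, u 6 = u6, u 7 = u7,
    v 0 = v0, v 1 = v1, v 2 = v2, v 3 = v3, v 4 = v4, v 5 = v5, v 6 = v6, v 7 = v7 at *
  rcases hu with hu | hu | hu | hu | hu | hu | hu | hu | hu | hu | hu | hu <;>
  rcases hv with hv | hv | hv | hv | hv | hv | hv | hv | hv | hv | hv | hv <;>
  grind

lemma degree_squarefreeExp (N : Finset (Fin 8)) : (squarefreeExp N).degree = N.card := by
  simp [squarefreeExp, map_sum]

lemma exists_isStandard_sub_mem (u : Fin 8 →₀ ℕ) :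
    (monomial u 1 : MvPolynomial (Fin 8) ℂ) ∈ surfaceIdeal ∨
      ∃ v, IsStandard v ∧ v.degree = u.degree ∧
        (monomial u 1 - monomial v 1 : MvPolynomial (Fin 8) ℂ) ∈ surfaceIdeal := by
  induction hk : u 4 + u 5 + u 6 using Nat.strong_induction_on generalizing u with
  | _ k ih =>
  have swap {N M : Finset (Fin 8)} (hN : N ⊆ u.support) (hc : N.card = M.card)
      (hw : ∀ w : Fin 8 →₀ ℕ, (w + squarefreeExp M) 4 + (w + squarefreeExp M) 5 +
        (w + squarefreeExp M) 6 < (w + squarefreeExp N) 4 + (w + squarefreeExp N) 5 +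
        (w + squarefreeExp N) 6)
      (hNM : (∏ i ∈ M, X i - ∏ i ∈ N, X i : MvPolynomial (Fin 8) ℂ) ∈ surfaceIdeal) :
      (monomial u 1 : MvPolynomial (Fin 8) ℂ) ∈ surfaceIdeal ∨
        ∃ v, IsStandard v ∧ v.degree = u.degree ∧
          (monomial u 1 - monomial v 1 : MvPolynomial (Fin 8) ℂ) ∈ surfaceIdeal := by
    obtain ⟨w, rfl⟩ := exists_eq_add_squarefreeExp hN
    have hd : (monomial (w + squarefreeExp N) 1 - monomial (w + squarefreeExp M) 1 :
        MvPolynomial (Fin 8) ℂ) ∈ surfaceIdeal := by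
      convert neg_mem (Ideal.mul_mem_left _ (monomial w 1) hNM) using 1
      simp [prod_X_eq_monomial, mul_sub, monomial_mul]
    rcases ih _ (hk ▸ hw w) _ rfl with h | ⟨v, hv, hvd, h⟩
    · left
      simpa using add_mem hd h
    · refine .inr ⟨v, hv, ?_, by simpa using add_mem hd h⟩
      rw [hvd, map_add, map_add, degree_squarefreeExp, degree_squarefreeExp, hc]
  obtain ⟨h1, h2, h3⟩ := sub_mem_surfaceIdeal
  rcases exists_vanishing_subset_or_subset_facet u.support with ⟨N, hN, h⟩ | h | h | h | h
  · left
    obtain ⟨w, rfl⟩ := exists_eq_add_squarefreeExp h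
    simpa [prod_X_eq_monomial, monomial_mul] using
      Ideal.mul_mem_left _ (monomial w 1) (prod_X_mem_surfaceIdeal hN)
  · exact swap (M := {1, 7}) h rfl (by simp [squarefreeExp_apply]; omega) (by simpa using h1)
  · exact swap (M := {2, 7}) h rfl (by simp [squarefreeExp_apply]; omega) (by simpa using h2)
  · exact swap (M := {3, 7}) h rfl (by simp [squarefreeExp_apply]; omega) (by simpa using h3)
  · exact .inr ⟨u, h, rfl, by simp⟩

lemma IsStandard.onCell {u : Fin 8 →₀ ℕ} (hu : IsStandard u) : OnCell u := by
  obtain ⟨F, hF, h⟩ := hu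
  have sub : ∀ F ∈ facets, ∃ C ∈ cells, F ⊆ C := by decide +kernel
  obtain ⟨C, hC, hFC⟩ := sub F hF
  exact ⟨C, hC, h.trans hFC⟩

/-- The standard monomials of degree `n`. -/
def standardExps (n : ℕ) : Finset (Fin 8 →₀ ℕ) :=
  (Finset.univ.finsuppAntidiag n).filter IsStandard

lemma mem_standardExps {n : ℕ} {u : Fin 8 →₀ ℕ} :
    u ∈ standardExps n ↔ u.degree = n ∧ IsStandard u := by
  simp [standardExps, Finsupp.degree_eq_sum]

lemma linearIndependent_standardExps (n : ℕ) :
    LinearIndependent ℂ fun v : standardExps n =>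
      Ideal.Quotient.mkₐ ℂ surfaceIdeal (monomial v.1 1) := by
  let f : (MvPolynomial (Fin 8) ℂ ⧸ surfaceIdeal) →ₗ[ℂ] ((Fin 5 → ℕ) →₀ ℂ) :=
    (surfaceIdeal.restrictScalars ℂ).liftQ toricProj fun _ hp => toricProj_eq_zero_of_mem hp
  refine LinearIndependent.of_comp f ?_
  have hf : (f ∘ fun v : standardExps n => Ideal.Quotient.mkₐ ℂ surfaceIdeal (monomial v.1 1)) =
      (fun d => Finsupp.single d (1 : ℂ)) ∘ fun v : standardExps n => multidegree v.1 := by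
    ext1 v
    change toricProj (monomial v.1 1) = _
    rw [toricProj_monomial, if_pos (mem_standardExps.1 v.2).2.onCell, one_smul]
    rfl
  rw [hf]
  refine (Finsupp.basisSingleOne (R := ℂ)).linearIndependent.comp _ fun u v h => ?_
  exact Subtype.ext (multidegree_injOn_isStandard (mem_standardExps.1 u.2).2
    (mem_standardExps.1 v.2).2 h)

lemma map_homogeneousSubmodule_eq_span (n : ℕ) :
    Submodule.map (Ideal.Quotient.mkₐ ℂ surfaceIdeal).toLinearMap
      (homogeneousSubmodule (Fin 8) ℂ n) =
    Submodule.span ℂ (Set.range fun v : standardExps n =>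
      Ideal.Quotient.mkₐ ℂ surfaceIdeal (monomial v.1 1)) := by
  apply le_antisymm
  · rw [Submodule.map_le_iff_le_comap]
    intro p hp
    rw [p.as_sum]
    refine sum_mem fun u hu => ?_
    have hdeg : u.degree = n := by
      rw [Finsupp.degree_eq_weight_one]
      exact hp (mem_support_iff.1 hu)
    rw [← mul_one (coeff u p), ← smul_eq_mul, ← smul_monomial]
    refine Submodule.smul_mem _ _ ?_
    rw [Submodule.mem_comap]
    rcases exists_isStandard_sub_mem u with h | ⟨v, hv, hvd, h⟩
    · have : (Ideal.Quotient.mkₐ ℂ surfaceIdeal).toLinearMap (monomial u 1) = 0 :=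
        Ideal.Quotient.eq_zero_iff_mem.2 h
      rw [this]
      exact zero_mem _
    · have : (Ideal.Quotient.mkₐ ℂ surfaceIdeal).toLinearMap (monomial u 1) =
          Ideal.Quotient.mkₐ ℂ surfaceIdeal (monomial v 1) :=
        Ideal.Quotient.eq.2 h
      rw [this]
      exact Submodule.subset_span ⟨⟨v, mem_standardExps.2 ⟨hvd.trans hdeg, hv⟩⟩, rfl⟩
  · rw [Submodule.span_le]
    rintro _ ⟨v, rfl⟩
    exact Submodule.mem_map_of_mem (f := (Ideal.Quotient.mkₐ ℂ surfaceIdeal).toLinearMap)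
      (isHomogeneous_monomial 1 (mem_standardExps.1 v.2).1)

lemma card_filter_support_eq (F : Finset (Fin 8)) {n : ℕ} (h : F.card ≤ n) :
    ((Finset.univ.finsuppAntidiag n).filter fun u : Fin 8 →₀ ℕ => u.support = F).card =
      (n - 1).choose (n - F.card) := by
  rw [show n - 1 = F.card + (n - F.card) - 1 by omega,
    ← Finset.card_finsuppAntidiag_nat_eq_choose]
  symm
  refine Finset.card_bij (fun w _ => w + squarefreeExp F) (fun w hw => ?_)
    (fun _ _ _ _ h => add_right_cancel h) fun u hu => ?_
  · obtain ⟨hs, hw⟩ := Finset.mem_finsuppAntidiag'.1 hw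
    have hs : w.degree = n - F.card := hs
    rw [Finset.mem_filter, support_add_squarefreeExp, Finset.union_eq_right.2 hw,
      Finset.mem_finsuppAntidiag]
    refine ⟨⟨?_, Finset.subset_univ _⟩, rfl⟩
    rw [← Finsupp.degree_eq_sum, map_add, hs, degree_squarefreeExp]
    omega
  · obtain ⟨hun, rfl⟩ := Finset.mem_filter.1 hu
    rw [Finset.mem_finsuppAntidiag, ← Finsupp.degree_eq_sum] at hun
    obtain ⟨w, hw⟩ := exists_eq_add_squarefreeExp (subset_refl u.support)
    have hd := congrArg Finsupp.degree hw
    rw [map_add, degree_squarefreeExp] at hd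
    refine ⟨w, Finset.mem_finsuppAntidiag'.2 ⟨?_, ?_⟩, hw.symm⟩
    · change w.degree = _
      omega
    · conv_rhs => rw [hw, support_add_squarefreeExp]
      exact Finset.subset_union_left

lemma card_standardExps (m : ℕ) :
    ((standardExps (m + 3)).card : ℤ) = 6 * ((m + 3 : ℕ) : ℤ) ^ 2 + 2 := by
  have hfaces : ∀ u ∈ standardExps (m + 3),
      u.support ∈ Finset.univ.filter fun s : Finset (Fin 8) => ∃ F ∈ facets, s ⊆ F :=
    fun u hu => Finset.mem_filter.2 ⟨Finset.mem_univ _, (mem_standardExps.1 hu).2⟩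
  have hcard : ∀ s ∈ Finset.univ.filter fun s : Finset (Fin 8) => ∃ F ∈ facets, s ⊆ F,
      s.card ∈ Finset.range 4 := by
    intro s hs
    obtain ⟨F, hF, hsF⟩ := (Finset.mem_filter.1 hs).2
    have h3 : ∀ F ∈ facets, F.card = 3 := by decide +kernel
    exact Finset.mem_range.2 (Nat.lt_succ_of_le ((Finset.card_le_card hsF).trans_eq (h3 F hF)))
  rw [Finset.card_eq_sum_card_fiberwise hfaces]
  have hfib : ∀ s ∈ Finset.univ.filter fun s : Finset (Fin 8) => ∃ F ∈ facets, s ⊆ F,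
      ((standardExps (m + 3)).filter fun u => u.support = s).card =
        (m + 2).choose (m + 3 - s.card) := by
    intro s hs
    have h3 := Finset.mem_range.1 (hcard s hs)
    rw [show m + 2 = m + 3 - 1 from rfl,
      ← card_filter_support_eq s (n := m + 3) (by omega), standardExps, Finset.filter_filter]
    congr 1
    refine Finset.filter_congr fun u _ => and_iff_right_of_imp ?_
    rintro rfl
    exact (Finset.mem_filter.1 hs).2
  rw [Finset.sum_congr rfl hfib,
    ← Finset.sum_fiberwise_of_maps_to' hcard fun k => (m + 2).choose (m + 3 - k)]
  have hcount : ∀ k ∈ Finset.range 4, ((Finset.univ.filter fun s : Finset (Fin 8) =>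
      ∃ F ∈ facets, s ⊆ F).filter fun s => s.card = k).card = [1, 8, 18, 12].getD k 0 := by
    have hk (k : ℕ) : (Finset.univ.filter fun s : Finset (Fin 8) => ∃ F ∈ facets, s ⊆ F).filter
        (fun s => s.card = k) = facets.biUnion (Finset.powersetCard k) := by
      ext s
      simp only [Finset.mem_filter, Finset.mem_univ, true_and, Finset.mem_biUnion,
        Finset.mem_powersetCard]
      exact ⟨fun ⟨⟨F, hF, h⟩, hc⟩ => ⟨F, hF, h, hc⟩, fun ⟨F, hF, h, hc⟩ => ⟨⟨F, hF, h⟩, hc⟩⟩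
    simp only [hk]
    decide +kernel
  simp only [Finset.sum_const]
  rw [Finset.sum_congr rfl fun k hk => by rw [hcount k hk]]
  have : ((m + 2).choose m : ℤ) * 2 = (m + 2) * (m + 1) := by
    have : ((m + 2).choose m : ℚ) * 2 = (m + 2) * (m + 1) := by
      rw [Nat.choose_symm_add, Nat.cast_choose_two]
      push_cast
      ring
    exact_mod_cast this
  simp [Finset.sum_range_succ, Nat.choose_succ_self_right]
  linear_combination 6 * this

end DegreeTwelve

/-- The ideal
`I = (x₀x₇, x₀x₄, x₀x₅, x₀x₆, x₁x₆, x₂x₅, x₃x₄, x₁x₇ - x₄x₅, x₂x₇ - x₄x₆, x₃x₇ - x₅x₆, x₁x₂x₃)`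
in `ℂ[x₀,…,x₇]` defines a projective scheme `X ⊂ ℙ⁷` of dimension 2 and degree
12: the homogeneous coordinate ring has Krull dimension 3 and its Hilbert
polynomial has leading term `6 t²` (i.e. `deg X = 2! · 6 = 12`). -/
theorem degree_twelve_degeneration
    (I : Ideal (MvPolynomial (Fin 8) ℂ))
    (hI : I = Ideal.span {X 0 * X 7, X 0 * X 4, X 0 * X 5, X 0 * X 6,
      X 1 * X 6, X 2 * X 5, X 3 * X 4,
      X 1 * X 7 - X 4 * X 5, X 2 * X 7 - X 4 * X 6, X 3 * X 7 - X 5 * X 6,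
      X 1 * X 2 * X 3}) :
    ringKrullDim (MvPolynomial (Fin 8) ℂ ⧸ I) = 3 ∧
    ∃ (N : ℕ) (c₁ c₀ : ℤ), ∀ n : ℕ, N ≤ n →
      (Module.finrank ℂ (Submodule.map (Ideal.Quotient.mkₐ ℂ I).toLinearMap
        (homogeneousSubmodule (Fin 8) ℂ n)) : ℤ)
        = 6 * (n : ℤ) ^ 2 + c₁ * n + c₀ := by
  obtain rfl : I = DegreeTwelve.surfaceIdeal := hI
  refine ⟨le_antisymm DegreeTwelve.ringKrullDim_quotient_surfaceIdeal_le
    DegreeTwelve.le_ringKrullDim_quotient_surfaceIdeal, 3, 0, 2, fun n hn => ?_⟩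
  obtain ⟨m, rfl⟩ := Nat.exists_eq_add_of_le' hn
  rw [DegreeTwelve.map_homogeneousSubmodule_eq_span,
    finrank_span_eq_card (DegreeTwelve.linearIndependent_standardExps _), Fintype.card_coe,
    DegreeTwelve.card_standardExps]
  ring
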